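/- Let w ∈ Wf and suppose t_{w^{−1}(η)} = w̃₂^{−1} w′ w̃₁ with w′ ∈ Wf, w̃₁, w̃₂ ∈ Wtf⁺ and w̃₁ ↑ w̃_h^{−1} w̃₂, where w^{−1}(η) = (w_j^{−1}(η₀))_j. Then w′ = w₀, w̃₂ = w̃_h w̃₁, the p-alcove w̃₁ · C₀ is p-restricted, and the Wf-component of w̃₁ equals w. -/

import Mathlib

/-!
Common setup: the extended affine Weyl group of `GL_n` (f-fold product), its dot
action on `(ℝ^n)^f`, p-alcoves, lengths, Bruhat orders (dominant and antidominant),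
the up (↑) order, admissible sets, and the combinatorics of lowest alcove
presentations, following Le–Le Hung–Levin, "Weight elimination in Serre-type
conjectures".
-/

noncomputable section

namespace LLLSerre

open scoped BigOperators

/-- `η₀ = (n-1, n-2, …, 1, 0)`. -/
def eta0 (n : ℕ) : Fin n → ℤ := fun i => (n : ℤ) - 1 - (i : ℤ)

/-- The action of a permutation on a vector: `(σ x) i = x (σ⁻¹ i)`. -/
def permAct {n : ℕ} {α : Type*} (σ : Equiv.Perm (Fin n)) (x : Fin n → α) : Fin n → α :=
  fun i => x (σ⁻¹ i)

/-- The weight lattice `Xf = (ℤ^n)^f`. -/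
abbrev Xf (n f : ℕ) := Fin f → Fin n → ℤ

/-- The f-fold product of Weyl groups `Wf = (S_n)^f`. -/
abbrev WfG (n f : ℕ) := Fin f → Equiv.Perm (Fin n)

/-- Points of `(ℝ^n)^f`. -/
abbrev RPt (n f : ℕ) := Fin f → Fin n → ℝ

/-- The extended affine Weyl group `Wtf = (X ⋊ W)^f`; the pair `(w, ν)` represents
`w t_ν`. -/
structure Wtf (n f : ℕ) where
  w : WfG n f
  t : Xf n f

/-- Multiplication in `Wtf`: `(w₁ t_{ν₁})(w₂ t_{ν₂}) = w₁w₂ t_{ν₂ + w₂⁻¹(ν₁)}`. -/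
def Wtf.mul {n f : ℕ} (a b : Wtf n f) : Wtf n f :=
  ⟨fun j => a.w j * b.w j, fun j => b.t j + permAct (b.w j)⁻¹ (a.t j)⟩

/-- Inversion in `Wtf`: `(w t_ν)⁻¹ = w⁻¹ t_{-w(ν)}`. -/
def Wtf.inv {n f : ℕ} (a : Wtf n f) : Wtf n f :=
  ⟨fun j => (a.w j)⁻¹, fun j => -(permAct (a.w j) (a.t j))⟩

/-- Embedding of the finite Weyl group `Wf` in `Wtf`. -/
def ofW {n f : ℕ} (w : WfG n f) : Wtf n f := ⟨w, fun _ _ => 0⟩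

/-- The translation `t_ν ∈ Wtf`. -/
def transl {n f : ℕ} (ν : Xf n f) : Wtf n f := ⟨fun _ => 1, ν⟩

/-- `η = (η₀, …, η₀) ∈ Xf`. -/
def etaf (n f : ℕ) : Xf n f := fun _ => eta0 n

/-- The longest element `w₀ ∈ Wf`. -/
def w0f (n f : ℕ) : WfG n f := fun _ => Fin.revPerm

/-- `w₀` as an element of `Wtf`. -/
def w0Elt (n f : ℕ) : Wtf n f := ofW (w0f n f)

/-- `w̃_h = w₀ t_{-η} ∈ Wtf`. -/
def whElt (n f : ℕ) : Wtf n f := ⟨w0f n f, fun _ i => -(eta0 n i)⟩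

/-- The dot action of `Wtf` on `(ℝ^n)^f`: `(w t_ν) · x = w(x + η + pν) − η`. -/
def dotR {n f : ℕ} (p : ℕ) (a : Wtf n f) (x : RPt n f) : RPt n f :=
  fun j i =>
    (x j ((a.w j)⁻¹ i) + ((eta0 n ((a.w j)⁻¹ i) : ℤ) : ℝ)
      + (p : ℝ) * ((a.t j ((a.w j)⁻¹ i) : ℤ) : ℝ)) - ((eta0 n i : ℤ) : ℝ)

/-- The dot action of `Wtf` on integral weights. -/
def dotZ {n f : ℕ} (p : ℕ) (a : Wtf n f) (lam : Xf n f) : Xf n f :=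
  fun j i =>
    (lam j ((a.w j)⁻¹ i) + eta0 n ((a.w j)⁻¹ i) + (p : ℤ) * a.t j ((a.w j)⁻¹ i)) - eta0 n i

/-- `⟨x_j + η₀, α_{ik}^∨⟩` for a real point `x`. -/
def prR {n f : ℕ} (x : RPt n f) (j : Fin f) (i k : Fin n) : ℝ :=
  (x j i + ((eta0 n i : ℤ) : ℝ)) - (x j k + ((eta0 n k : ℤ) : ℝ))

/-- `⟨λ_j + η₀, α_{ik}^∨⟩` for a weight `λ`. -/
def prZ {n f : ℕ} (lam : Xf n f) (j : Fin f) (i k : Fin n) : ℤ :=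
  (lam j i + eta0 n i) - (lam j k + eta0 n k)

/-- A point is (p-)regular if it lies on none of the affine hyperplanes
`⟨x_j + η₀, α^∨⟩ = pm`. -/
def regular {n f : ℕ} (p : ℕ) (x : RPt n f) : Prop :=
  ∀ (j : Fin f) (i k : Fin n) (m : ℤ), i < k → prR x j i k ≠ (p : ℝ) * (m : ℝ)

/-- Two regular points lie in the same p-alcove (same side of every hyperplane). -/
def sameAlcove {n f : ℕ} (p : ℕ) (x y : RPt n f) : Prop :=
  regular p x ∧ regular p y ∧
    ∀ (j : Fin f) (i k : Fin n) (m : ℤ), i < k →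
      (prR x j i k < (p : ℝ) * (m : ℝ) ↔ prR y j i k < (p : ℝ) * (m : ℝ))

/-- The root `α_{ik} = e_i - e_k` as a real vector. -/
def rootR {n : ℕ} (i k i' : Fin n) : ℝ :=
  (if i' = i then (1 : ℝ) else 0) - (if i' = k then (1 : ℝ) else 0)

/-- The affine reflection across the hyperplane `⟨x_j + η₀, α_{ik}^∨⟩ = pm`:
it replaces `x_j` by `x_j − (⟨x_j + η₀, α_{ik}^∨⟩ − pm) α_{ik}`. -/
def reflPt {n f : ℕ} (p : ℕ) (j : Fin f) (i k : Fin n) (m : ℤ) (x : RPt n f) : RPt n f :=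
  fun j' i' =>
    if j' = j then x j' i' - (prR x j i k - (p : ℝ) * (m : ℝ)) * rootR i k i' else x j' i'

/-- The origin, a point of the base alcove `C₀` (when `p > n`). -/
def basePt (n f : ℕ) : RPt n f := fun _ _ => 0

/-- The hyperplane indexed by `(j, i, k, m)` separates `x` from `y`. -/
def separates {n f : ℕ} (p : ℕ) (x y : RPt n f) (j : Fin f) (i k : Fin n) (m : ℤ) : Prop :=
  (prR x j i k < (p : ℝ) * (m : ℝ) ∧ (p : ℝ) * (m : ℝ) < prR y j i k) ∨
  (prR y j i k < (p : ℝ) * (m : ℝ) ∧ (p : ℝ) * (m : ℝ) < prR x j i k)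

/-- The length of `a ∈ Wtf` measured from the alcove of the base point `x`:
the number of hyperplanes separating the alcove of `x` from its image under `a`. -/
def lenFrom {n f : ℕ} (p : ℕ) (x : RPt n f) (a : Wtf n f) : ℕ :=
  Set.ncard {q : Fin f × Fin n × Fin n × ℤ |
    q.2.1 < q.2.2.1 ∧ separates p x (dotR p a x) q.1 q.2.1 q.2.2.1 q.2.2.2}

/-- Length relative to the dominant base alcove `C₀`. -/
def len {n f : ℕ} (p : ℕ) (a : Wtf n f) : ℕ := lenFrom p (basePt n f) a

/-- A point of the antidominant base alcove `w₀ · C₀`. -/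
def antiBasePt (n f p : ℕ) : RPt n f := dotR p (w0Elt n f) (basePt n f)

/-- Length relative to the antidominant base alcove `w₀ · C₀`. -/
def lenV {n f : ℕ} (p : ℕ) (a : Wtf n f) : ℕ := lenFrom p (antiBasePt n f p) a

/-- The affine Weyl group `Waf = (Λ_R ⋊ W)^f ⊆ Wtf`. -/
def Waf (n f : ℕ) : Set (Wtf n f) := {a | ∀ j, (∑ i, a.t j i) = 0}

/-- The stabilizer `Ωf` of the dominant base alcove `C₀`. -/
def Omegaf (n f p : ℕ) : Set (Wtf n f) :=
  {a | sameAlcove p (basePt n f) (dotR p a (basePt n f))}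

/-- The stabilizer of the antidominant base alcove `w₀ · C₀`. -/
def OmegaV (n f p : ℕ) : Set (Wtf n f) :=
  {a | sameAlcove p (antiBasePt n f p) (dotR p a (antiBasePt n f p))}

/-- `a ∈ Wtf` acts via the dot action as the affine reflection in a single hyperplane. -/
def isRefl {n f : ℕ} (p : ℕ) (a : Wtf n f) : Prop :=
  ∃ (j : Fin f) (i k : Fin n) (m : ℤ), i < k ∧ ∀ x, dotR p a x = reflPt p j i k m x

/-- One step of the Bruhat order (relative to the base point `x`):
`u < r u` for `r` a reflection with `ℓ(u) < ℓ(r u)`. -/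
def bruhatStepFrom {n f : ℕ} (p : ℕ) (x : RPt n f) (u v : Wtf n f) : Prop :=
  ∃ r, isRefl p r ∧ v = Wtf.mul r u ∧ lenFrom p x u < lenFrom p x v

/-- The Bruhat order on `Wtf` relative to the base alcove with representative
point `x` and stabilizer `Ω`: on `Waf` it is generated by the reflection steps,
and is extended to `Wtf` by `u ω ≤ v ω` for `u ≤ v` in `Waf`, `ω ∈ Ω`. -/
def bruhatLEFrom {n f : ℕ} (p : ℕ) (x : RPt n f) (Om : Set (Wtf n f)) (a b : Wtf n f) : Prop :=
  ∃ u v ω, u ∈ Waf n f ∧ v ∈ Waf n f ∧ ω ∈ Om ∧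
    a = Wtf.mul u ω ∧ b = Wtf.mul v ω ∧
    Relation.ReflTransGen (bruhatStepFrom p x) u v

/-- The Bruhat order on `Wtf` relative to the dominant base alcove. -/
def bruhatLE {n f : ℕ} (p : ℕ) (a b : Wtf n f) : Prop :=
  bruhatLEFrom p (basePt n f) (Omegaf n f p) a b

/-- The Bruhat order on `Wtf` relative to the antidominant base alcove. -/
def bruhatLEV {n f : ℕ} (p : ℕ) (a b : Wtf n f) : Prop :=
  bruhatLEFrom p (antiBasePt n f p) (OmegaV n f p) a b

/-- The admissible set `Adm(λ) = {w̃ : w̃ ≤ t_{σ(λ)} for some σ ∈ Wf}` (dominant order). -/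
def Adm {n f : ℕ} (p : ℕ) (lam : Xf n f) : Set (Wtf n f) :=
  {a | ∃ σ : WfG n f, bruhatLE p a (transl (fun j => permAct (σ j) (lam j)))}

/-- The admissible set `Adm∨(λ)` (antidominant order). -/
def AdmV {n f : ℕ} (p : ℕ) (lam : Xf n f) : Set (Wtf n f) :=
  {a | ∃ σ : WfG n f, bruhatLEV p a (transl (fun j => permAct (σ j) (lam j)))}

/-- The anti-automorphism `w̃ = w t_ν ↦ w̃* = t_{ν*} w*` of `Wtf`, where
`(w*)_j = (w_{f-1-j})⁻¹` and `(ν*)_j = ν_{f-1-j}`. -/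
def wstar {n f : ℕ} (a : Wtf n f) : Wtf n f :=
  ⟨fun j => (a.w (Fin.rev j))⁻¹, fun j => permAct (a.w (Fin.rev j)) (a.t (Fin.rev j))⟩

/-- `ν ↦ ν*` on weights: `(ν*)_j = ν_{f-1-j}`. -/
def xstar {n f : ℕ} (lam : Xf n f) : Xf n f := fun j => lam (Fin.rev j)

/-- The cyclic shift `π` on weights: `(πν)_j = ν_{j-1}`. -/
def sh {n f : ℕ} (ν : Xf n f) : Xf n f := fun j => ν ((finRotate f)⁻¹ j)

/-- The cyclic shift `π` on `Wf`: `(πσ)_j = σ_{j-1}`. -/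
def shW {n f : ℕ} (σ : WfG n f) : WfG n f := fun j => σ ((finRotate f)⁻¹ j)

/-- The `Wf`-part of `^(ν,σ)(w, μ)`, namely `σ w π(σ)⁻¹`. -/
def conjW {n f : ℕ} (σ w : WfG n f) : WfG n f := fun j => σ j * w j * (shW σ j)⁻¹

/-- The `Xf`-part of `^(ν,σ)(w, μ)`, namely `σ(μ) + pν − σwπ(σ)⁻¹ π(ν)`. -/
def conjX {n f : ℕ} (p : ℕ) (ν : Xf n f) (σ w : WfG n f) (μ : Xf n f) : Xf n f :=
  fun j i => permAct (σ j) (μ j) i + (p : ℤ) * ν j i - permAct (conjW σ w j) (sh ν j) i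

/-- `(w, μ) ∼ (w', μ')`: `(w', μ') = ^(ν,σ)(w, μ)` for some `(ν, σ)`. -/
def pairEquiv {n f : ℕ} (p : ℕ) (w : WfG n f) (μ : Xf n f) (w' : WfG n f) (μ' : Xf n f) : Prop :=
  ∃ (ν : Xf n f) (σ : WfG n f), w' = conjW σ w ∧ μ' = conjX p ν σ w μ

/-- `λ` is m-deep in the base alcove `C₀`:
`m < ⟨λ_j + η₀, α^∨⟩ < p − m` for all `j` and positive coroots `α^∨`. -/
def deep {n f : ℕ} (p m : ℕ) (lam : Xf n f) : Prop :=
  ∀ (j : Fin f) (i k : Fin n), i < k →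
    (m : ℤ) < prZ lam j i k ∧ prZ lam j i k < (p : ℤ) - (m : ℤ)

/-- `λ` lies m-deep in its own p-alcove. -/
def deepInAlcove {n f : ℕ} (p m : ℕ) (lam : Xf n f) : Prop :=
  ∀ (j : Fin f) (i k : Fin n), i < k →
    ∃ N : ℤ, (p : ℤ) * N + (m : ℤ) < prZ lam j i k ∧
      prZ lam j i k < (p : ℤ) * (N + 1) - (m : ℤ)

/-- The p-restricted weights `X₁`. -/
def X1 (n f p : ℕ) : Set (Xf n f) :=
  {lam | ∀ (j : Fin f) (i : Fin n) (h : (i : ℕ) + 1 < n),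
    0 ≤ lam j i - lam j ⟨(i : ℕ) + 1, h⟩ ∧ lam j i - lam j ⟨(i : ℕ) + 1, h⟩ ≤ (p : ℤ) - 1}

/-- `X⁰`: weights pairing to 0 with every coroot. -/
def X0 (n f : ℕ) : Set (Xf n f) := {lam | ∀ (j : Fin f) (i k : Fin n), lam j i = lam j k}

/-- The alcove of the regular point `x` is dominant. -/
def dominantPt {n f : ℕ} (x : RPt n f) : Prop :=
  ∀ (j : Fin f) (i k : Fin n), i < k → 0 < prR x j i k

/-- The alcove of the regular point `x` is p-restricted. -/
def restrictedPt {n f : ℕ} (p : ℕ) (x : RPt n f) : Prop :=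
  ∀ (j : Fin f) (i : Fin n) (h : (i : ℕ) + 1 < n),
    0 < prR x j i ⟨(i : ℕ) + 1, h⟩ ∧ prR x j i ⟨(i : ℕ) + 1, h⟩ < (p : ℝ)

/-- `Wtf⁺`: the elements sending `C₀` to a dominant alcove under the dot action. -/
def WtfPlus (n f p : ℕ) : Set (Wtf n f) := {a | dominantPt (dotR p a (basePt n f))}

/-- One step of the up (↑) order on alcoves, via representative points:
stay in the same alcove, or apply a reflection across a hyperplane lying above. -/
def upStep {n f : ℕ} (p : ℕ) (x y : RPt n f) : Prop :=
  sameAlcove p x y ∨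
    ∃ (j : Fin f) (i k : Fin n) (m : ℤ), i < k ∧ prR x j i k < (p : ℝ) * (m : ℝ) ∧
      y = reflPt p j i k m x

/-- The up (↑) order on p-alcoves, via representative points. -/
def alcoveLE {n f : ℕ} (p : ℕ) (x y : RPt n f) : Prop :=
  Relation.ReflTransGen (upStep p) x y

/-- `w̃₁ ↑ w̃₂` on `Wtf`: `w̃₁ · C₀ ↑ w̃₂ · C₀` and `w̃₁, w̃₂` in the same right
`Waf`-coset. -/
def upOrd {n f : ℕ} (p : ℕ) (a b : Wtf n f) : Prop :=
  alcoveLE p (dotR p a (basePt n f)) (dotR p b (basePt n f)) ∧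
    Wtf.mul a (Wtf.inv b) ∈ Waf n f

/-- Realification of an integral weight. -/
def toR {n f : ℕ} (lam : Xf n f) : RPt n f := fun j i => ((lam j i : ℤ) : ℝ)

/-- The `Wf`-orbit of a point of `(ℝ^n)^f`. -/
def orbitR {n f : ℕ} (y : RPt n f) : Set (RPt n f) :=
  Set.range fun σ : WfG n f => fun j => permAct (σ j) (y j)

end LLLSerre

namespace LLLSerre

theorem eta0_strictAnti (n : ℕ) : StrictAnti (fun i : Fin n => ((eta0 n i : ℤ) : ℝ)) := by
  intro i k h
  have h' : (i : ℕ) < k := h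
  simp only [eta0, Int.cast_lt]
  omega

/-- The rearrangement inequality for strictly decreasing vectors, with its equality case. -/
theorem perm_eq_one_of_sum_le {n : ℕ} {a x : Fin n → ℝ} (ha : StrictAnti a) (hx : StrictAnti x)
    (σ : Equiv.Perm (Fin n)) (h : ∑ i, a i * x i ≤ ∑ i, a i * x (σ i)) : σ = 1 := by
  have hm : Monovary a x := fun i k hik => ha.antitone (hx.lt_iff_gt.1 hik).le
  have heq := hm.sum_mul_comp_perm_eq_sum_mul_iff.1
    (le_antisymm hm.sum_mul_comp_perm_le_sum_mul h)
  refine (Equiv.Perm.monotone_iff σ).1 fun i k hik => ?_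
  by_contra hlt
  have h1 : a i ≤ a k := heq (hx (not_le.1 hlt))
  have h2 : k ≤ i := ha.le_iff_ge.1 h1
  exact hlt (by rw [le_antisymm hik h2])

theorem sum_mul_comp_perm_le {n : ℕ} {a x : Fin n → ℝ} (ha : StrictAnti a) (hx : StrictAnti x)
    (σ : Equiv.Perm (Fin n)) : ∑ i, a i * x (σ i) ≤ ∑ i, a i * x i :=
  Monovary.sum_mul_comp_perm_le_sum_mul fun _ _ hik => ha.antitone (hx.lt_iff_gt.1 hik).le

/-- Two dominant vectors related as in `t_{w⁻¹(η)} = w̃₂⁻¹ w' w̃₁` whose images are comparable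
have the expected finite Weyl group components. -/
theorem perm_eq_of_dominant {n : ℕ} {a x y : Fin n → ℝ} (ha : StrictAnti a) (hx : StrictAnti x)
    (hy : StrictAnti y) (c : ℝ) (u v w : Equiv.Perm (Fin n))
    (hrel : ∀ i, y (v i) = x (u i) - c * a (w i))
    (hle : ∑ i, a i * x i ≤ ∑ i, a i * (y (Fin.rev i) + c * a i)) :
    u = w ∧ v = Fin.revPerm * w := by
  have hz : StrictAnti (fun i => -y (Fin.rev i)) := fun i k h => by
    simpa using hy (Fin.rev_lt_rev.2 h)
  have hsum : ∑ i, a i * x ((u * w⁻¹) i)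
      = ∑ i, a i * y ((v * w⁻¹) i) + ∑ i, a i * (c * a i) := by
    rw [← Finset.sum_add_distrib]
    refine Finset.sum_congr rfl fun i _ => ?_
    have := hrel (w⁻¹ i)
    rw [show w (w⁻¹ i) = i by simp] at this
    simp only [Equiv.Perm.mul_apply, this]
    ring
  have hzneg : ∀ τ : Equiv.Perm (Fin n),
      ∑ i, a i * -y (Fin.rev (τ i)) = -∑ i, a i * y (Fin.rev (τ i)) := fun τ => by
    simp
  have h1 := sum_mul_comp_perm_le ha hx (u * w⁻¹)
  have h2 := sum_mul_comp_perm_le ha hz (Fin.revPerm * (v * w⁻¹))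
  have h3 := perm_eq_one_of_sum_le ha hx (u * w⁻¹)
  have h4 := perm_eq_one_of_sum_le ha hz (Fin.revPerm * (v * w⁻¹))
  have hz1 := hzneg 1
  simp only [Equiv.Perm.one_apply] at hz1
  rw [hzneg, hz1] at h2 h4
  simp only [Equiv.Perm.mul_apply (Fin.revPerm), Fin.revPerm_apply, Fin.rev_rev] at h2 h4
  simp only [mul_add, Finset.sum_add_distrib] at hle
  have e1 := h3 (by linarith)
  have e2 := h4 (by linarith)
  refine ⟨mul_inv_eq_one.1 e1, ?_⟩
  rw [← mul_assoc, mul_inv_eq_one] at e2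
  rw [← e2, ← mul_assoc]
  ext i
  simp

theorem dotR_mul {n f : ℕ} (p : ℕ) (a b : Wtf n f) (x : RPt n f) :
    dotR p (Wtf.mul a b) x = dotR p a (dotR p b x) := by
  funext j i
  simp [dotR, Wtf.mul, permAct]
  ring

theorem dotR_inv_dotR {n f : ℕ} (p : ℕ) (a : Wtf n f) (x : RPt n f) :
    dotR p (Wtf.inv a) (dotR p a x) = x := by
  funext j i
  simp [dotR, Wtf.inv, permAct]

theorem dotR_dotR_inv {n f : ℕ} (p : ℕ) (a : Wtf n f) (x : RPt n f) :
    dotR p a (dotR p (Wtf.inv a) x) = x := by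
  funext j i
  simp [dotR, Wtf.inv, permAct]

/-- `x` and `y` lie on the same open side of every affine hyperplane, for all (not necessarily
positive) coroots. -/
def SameSides {n f : ℕ} (p : ℕ) (x y : RPt n f) : Prop :=
  ∀ (j : Fin f) (i k : Fin n) (m : ℤ), i ≠ k →
    (prR x j i k < (p : ℝ) * (m : ℝ) ↔ prR y j i k < (p : ℝ) * (m : ℝ))

theorem SameSides.refl {n f : ℕ} (p : ℕ) (x : RPt n f) : SameSides p x x :=
  fun _ _ _ _ _ => Iff.rfl

theorem SameSides.trans {n f p : ℕ} {x y z : RPt n f} (h : SameSides p x y)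
    (h' : SameSides p y z) : SameSides p x z :=
  fun j i k m hik => (h j i k m hik).trans (h' j i k m hik)

theorem sameAlcove.sameSides {n f p : ℕ} {x y : RPt n f} (h : sameAlcove p x y) :
    SameSides p x y := by
  obtain ⟨hx, hy, h⟩ := h
  intro j i k m hik
  rcases lt_or_gt_of_ne hik with hlt | hgt
  · exact h j i k m hlt
  · have hflip : ∀ z : RPt n f, regular p z →
        (prR z j i k < (p : ℝ) * (m : ℝ) ↔ ¬ prR z j k i < (p : ℝ) * ((-m : ℤ) : ℝ)) := by
      intro z hz
      have hne := hz j k i (-m) hgt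
      have hneg : prR z j i k = -prR z j k i := by simp only [prR]; ring
      rw [not_lt, le_iff_lt_or_eq, or_iff_left hne.symm, hneg]
      push_cast
      constructor <;> intro <;> linarith
    rw [hflip x hx, hflip y hy, h j k i (-m) hgt]

theorem SameSides.dotR {n f p : ℕ} {x y : RPt n f} (h : SameSides p x y) (a : Wtf n f) :
    SameSides p (dotR p a x) (dotR p a y) := by
  intro j i k m hik
  have key : ∀ z : RPt n f, (prR (LLLSerre.dotR p a z) j i k < (p : ℝ) * (m : ℝ) ↔
      prR z j ((a.w j)⁻¹ i) ((a.w j)⁻¹ k) <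
        (p : ℝ) * ((m - a.t j ((a.w j)⁻¹ i) + a.t j ((a.w j)⁻¹ k) : ℤ) : ℝ)) := by
    intro z
    simp only [prR, LLLSerre.dotR]
    push_cast
    constructor <;> intro <;> linarith
  rw [key, key]
  exact h _ _ _ _ (by simpa using hik)

/-- The element of `Wtf` acting as the affine reflection `reflPt p j i k m`. -/
def reflElt {n f : ℕ} (j : Fin f) (i k : Fin n) (m : ℤ) : Wtf n f where
  w := fun j' => if j' = j then Equiv.swap i k else 1
  t := fun j' i' => if j' = j then (if i' = k then m else 0) - (if i' = i then m else 0) else 0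

theorem dotR_reflElt {n f : ℕ} (p : ℕ) (j : Fin f) {i k : Fin n} (hik : i ≠ k) (m : ℤ)
    (x : RPt n f) : dotR p (reflElt j i k m) x = reflPt p j i k m x := by
  funext j' i'
  by_cases hj : j' = j
  · subst hj
    by_cases h1 : i' = i
    · subst h1
      simp [dotR, reflElt, reflPt, rootR, prR, hik, hik.symm]
      ring
    · by_cases h2 : i' = k
      · subst h2
        simp [dotR, reflElt, reflPt, rootR, prR, hik, hik.symm]
        ring
      · simp [dotR, reflElt, reflPt, rootR, prR, h1, h2, Equiv.swap_apply_of_ne_of_ne]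
  · simp [dotR, reflElt, reflPt, hj]

theorem sum_mul_t {n f : ℕ} (a b : Wtf n f) (j : Fin f) :
    ∑ i, (Wtf.mul a b).t j i = ∑ i, a.t j i + ∑ i, b.t j i := by
  simp only [Wtf.mul, permAct, Pi.add_apply, inv_inv, Finset.sum_add_distrib]
  rw [Equiv.sum_comp (b.w j) (a.t j), add_comm]

theorem sum_inv_t {n f : ℕ} (a : Wtf n f) (j : Fin f) :
    ∑ i, (Wtf.inv a).t j i = -∑ i, a.t j i := by
  simp only [Wtf.inv, permAct, Pi.neg_apply, Finset.sum_neg_distrib]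
  rw [Equiv.sum_comp (a.w j)⁻¹ (a.t j)]

theorem sum_reflElt_t {n f : ℕ} (j : Fin f) (i k : Fin n) (m : ℤ) (j' : Fin f) :
    ∑ i', (reflElt j i k m).t j' i' = 0 := by
  by_cases h : j' = j <;> simp [reflElt, h]

/-- Pairing with `η₀` in the `j`-th component; it increases along the up order. -/
def etaPair {n f : ℕ} (x : RPt n f) (j : Fin f) : ℝ :=
  ∑ i, ((eta0 n i : ℤ) : ℝ) * (x j i + ((eta0 n i : ℤ) : ℝ))

theorem etaPair_le_reflPt {n f p : ℕ} {x : RPt n f} {j : Fin f} {i k : Fin n} {m : ℤ}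
    (hik : i < k) (h : prR x j i k < (p : ℝ) * (m : ℝ)) (j' : Fin f) :
    etaPair x j' ≤ etaPair (reflPt p j i k m x) j' := by
  by_cases hj : j' = j
  · subst hj
    have hdiff : etaPair (reflPt p j' i k m x) j' = etaPair x j' +
        ((p : ℝ) * (m : ℝ) - prR x j' i k) * (((eta0 n i : ℤ) : ℝ) - ((eta0 n k : ℤ) : ℝ)) := by
      have hroot : ∑ i', ((eta0 n i' : ℤ) : ℝ) * rootR i k i'
          = ((eta0 n i : ℤ) : ℝ) - ((eta0 n k : ℤ) : ℝ) := by
        simp [rootR, mul_sub]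
      rw [← hroot, etaPair, etaPair, Finset.mul_sum, ← Finset.sum_add_distrib]
      refine Finset.sum_congr rfl fun i' _ => ?_
      simp only [reflPt, if_true]
      ring
    have h1 : ((eta0 n k : ℤ) : ℝ) < ((eta0 n i : ℤ) : ℝ) := eta0_strictAnti n hik
    rw [hdiff]
    have := mul_nonneg (sub_nonneg.2 h.le) (sub_nonneg.2 h1.le)
    linarith
  · simp [etaPair, reflPt, hj]

/-- If `x ↑ y`, then `y` lies in the same alcove as some `a · x` with `a ∈ Waf` that is
above `x`. -/
theorem alcoveLE.exists_dotR {n f p : ℕ} {x y : RPt n f} (h : alcoveLE p x y) :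
    ∃ a ∈ Waf n f, SameSides p (dotR p a x) y ∧ ∀ j, etaPair x j ≤ etaPair (dotR p a x) j := by
  induction h with
  | refl =>
    have h1 : dotR p (ofW fun _ => 1) x = x := by
      funext j i
      simp [dotR, ofW]
    refine ⟨ofW fun _ => 1, fun j => by simp [ofW], ?_, fun j => ?_⟩
    · rw [h1]
      exact SameSides.refl p x
    · rw [h1]
  | tail _ hstep ih =>
    obtain ⟨a, ha, hs, hle⟩ := ih
    rcases hstep with hsame | ⟨j, i, k, m, hik, hlt, rfl⟩
    · exact ⟨a, ha, hs.trans hsame.sameSides, hle⟩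
    · refine ⟨Wtf.mul (reflElt j i k m) a, fun j' => ?_, ?_, fun j' => ?_⟩
      · rw [sum_mul_t, sum_reflElt_t, ha j', add_zero]
      · rw [dotR_mul, ← dotR_reflElt p j hik.ne]
        exact hs.dotR _
      · rw [dotR_mul, dotR_reflElt p j hik.ne]
        exact (hle j').trans (etaPair_le_reflPt hik ((hs j i k m hik.ne).2 hlt) j')

/-- A vector of integers with zero sum whose entries differ by at most one vanishes. -/
theorem eq_zero_of_sum_eq_zero {ι : Type*} [Fintype ι] {v : ι → ℤ} (hv : ∀ i k, v i - v k ≤ 1)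
    (hsum : ∑ i, v i = 0) : ∀ i, v i = 0 := by
  by_cases h : ∃ i, 1 ≤ v i
  · obtain ⟨i, hi⟩ := h
    have hnn : ∀ k ∈ Finset.univ, 0 ≤ v k := fun k _ => by have := hv i k; omega
    exact fun k => (Finset.sum_eq_zero_iff_of_nonneg hnn).1 hsum k (Finset.mem_univ k)
  · push Not at h
    have hnp : ∀ k ∈ Finset.univ, v k ≤ 0 := fun k _ => by have := h k; omega
    exact fun k => (Finset.sum_eq_zero_iff_of_nonpos hnp).1 hsum k (Finset.mem_univ k)

/-- `Waf` acts freely on the orbit of the base alcove. -/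
theorem dotR_basePt_eq_of_sameSides {n f p : ℕ} (hnp : n < p) {c : Wtf n f} (hc : c ∈ Waf n f)
    (h : SameSides p (dotR p c (basePt n f)) (basePt n f)) :
    dotR p c (basePt n f) = basePt n f := by
  have key : ∀ j, c.w j = 1 ∧ ∀ i, c.t j i = 0 := by
    intro j
    set s := (c.w j)⁻¹ with hs
    have hb : ∀ i k : Fin n, i < k →
        0 ≤ ((s k : ℕ) : ℤ) - (s i : ℕ) + p * (c.t j (s i) - c.t j (s k)) ∧
        ((s k : ℕ) : ℤ) - (s i : ℕ) + p * (c.t j (s i) - c.t j (s k)) < p := by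
      intro i k hik
      have hik' : (i : ℕ) < k := hik
      have hk := k.isLt
      have hbase : prR (basePt n f) j i k = (((k : ℕ) - (i : ℕ) : ℤ) : ℝ) := by
        simp [prR, basePt, eta0]
      have hdot : prR (dotR p c (basePt n f)) j i k
          = ((((s k : ℕ) : ℤ) - (s i : ℕ) + p * (c.t j (s i) - c.t j (s k)) : ℤ) : ℝ) := by
        simp only [prR, basePt, eta0, dotR, ← hs]
        push_cast
        ring
      have h0 := h j i k 0 hik.ne
      have h1 := h j i k 1 hik.ne
      have e0 : (p : ℝ) * ((0 : ℤ) : ℝ) = ((0 : ℤ) : ℝ) := by simp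
      have e1 : (p : ℝ) * ((1 : ℤ) : ℝ) = ((p : ℤ) : ℝ) := by simp
      rw [hbase, hdot, e0, Int.cast_lt, Int.cast_lt] at h0
      rw [hbase, hdot, e1, Int.cast_lt, Int.cast_lt] at h1
      constructor
      · by_contra hneg
        have := h0.1 (not_le.1 hneg)
        omega
      · exact h1.2 (by omega)
    have hv : ∀ i k, c.t j (s i) - c.t j (s k) ≤ 1 := by
      intro i k
      have hi := (s i).isLt
      have hk := (s k).isLt
      rcases lt_trichotomy i k with hik | rfl | hik
      · have := (hb i k hik).2
        by_contra hcon
        nlinarith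
      · simp
      · have := (hb k i hik).1
        by_contra hcon
        nlinarith
    have hsum : ∑ i, c.t j (s i) = 0 := by
      rw [Equiv.sum_comp s (c.t j)]
      exact hc j
    have hzero := eq_zero_of_sum_eq_zero hv hsum
    refine ⟨?_, fun i => by simpa using hzero (s⁻¹ i)⟩
    have hmono : Monotone s := by
      refine monotone_iff_forall_lt.2 fun i k hik => ?_
      have := (hb i k hik).1
      rw [hzero, hzero] at this
      rw [Fin.le_def]
      omega
    have hs1 : s = 1 := (Equiv.Perm.monotone_iff s).1 hmono
    exact inv_eq_one.1 hs1
  funext j i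
  simp [dotR, basePt, (key j).1, (key j).2]

/-- Comparability of `a` and `b` in the up order bounds the pairing with `η₀`. -/
theorem upOrd.etaPair_le {n f p : ℕ} (hnp : n < p) {a b : Wtf n f} (h : upOrd p a b) (j : Fin f) :
    etaPair (dotR p a (basePt n f)) j ≤ etaPair (dotR p b (basePt n f)) j := by
  obtain ⟨hle, hW⟩ := h
  obtain ⟨r, hr, hs, hmono⟩ := hle.exists_dotR
  have hc : Wtf.mul (Wtf.inv b) (Wtf.mul r a) ∈ Waf n f := by
    intro j'
    have h1 := hW j'
    have h2 := hr j'
    rw [sum_mul_t, sum_inv_t] at h1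
    rw [sum_mul_t, sum_mul_t, sum_inv_t]
    linarith
  have hs' := hs.dotR (Wtf.inv b)
  rw [dotR_inv_dotR, ← dotR_mul p r a, ← dotR_mul p (Wtf.inv b)] at hs'
  have heq := dotR_basePt_eq_of_sameSides hnp hc hs'
  rw [dotR_mul, dotR_mul] at heq
  have heq' := congrArg (dotR p b) heq
  rw [dotR_dotR_inv] at heq'
  rw [← heq']
  exact hmono j

theorem dominantPt.strictAnti {n f : ℕ} {x : RPt n f} (h : dominantPt x) (j : Fin f) :
    StrictAnti (fun i => x j i + ((eta0 n i : ℤ) : ℝ)) :=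
  fun i k hik => sub_pos.1 (h j i k hik)

/-- if `t_{w⁻¹(η)} = w̃₂⁻¹ w' w̃₁` with `w' ∈ Wf`, `w̃₁, w̃₂ ∈ Wtf⁺`
and `w̃₁ ↑ w̃_h⁻¹ w̃₂`, then `w' = w₀`, `w̃₂ = w̃_h w̃₁`, the alcove `w̃₁ · C₀` is
p-restricted, and the `Wf`-component of `w̃₁` equals `w`. -/
theorem statement14 (n f p : ℕ) (hn : 2 ≤ n) (hf : 1 ≤ f) (hp : p.Prime) (hnp : n < p)
    (w w' : WfG n f) (w1 w2 : Wtf n f)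
    (h1 : w1 ∈ WtfPlus n f p) (h2 : w2 ∈ WtfPlus n f p)
    (hup : upOrd p w1 (Wtf.mul (Wtf.inv (whElt n f)) w2))
    (hfact : transl (fun j => permAct (w j)⁻¹ (eta0 n)) =
      Wtf.mul (Wtf.inv w2) (Wtf.mul (ofW w') w1)) :
    w' = w0f n f ∧ w2 = Wtf.mul (whElt n f) w1 ∧
      restrictedPt p (dotR p w1 (basePt n f)) ∧ w1.w = w := by
  have hw : ∀ j, w2.w j = w' j * w1.w j := fun j => by
    have h := congrFun (congrArg Wtf.w hfact) j
    simp only [transl, Wtf.mul, Wtf.inv, ofW] at h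
    exact inv_mul_eq_one.1 h.symm
  have ht : ∀ j i, w2.t j i = w1.t j i - eta0 n (w j i) := fun j i => by
    have h := congrFun (congrFun (congrArg Wtf.t hfact) j) i
    simp [transl, Wtf.mul, Wtf.inv, ofW, permAct, hw] at h
    linarith
  have hd1 : ∀ j i, dotR p w1 (basePt n f) j (w1.w j i) + ((eta0 n (w1.w j i) : ℤ) : ℝ)
      = eta0 n i + p * w1.t j i := fun j i => by simp [dotR, basePt]
  have hd2 : ∀ j i, dotR p w2 (basePt n f) j (w2.w j i) + ((eta0 n (w2.w j i) : ℤ) : ℝ)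
      = eta0 n i + p * w2.t j i := fun j i => by simp [dotR, basePt]
  have hrel : ∀ j i, dotR p w2 (basePt n f) j (w2.w j i) + ((eta0 n (w2.w j i) : ℤ) : ℝ)
      = dotR p w1 (basePt n f) j (w1.w j i) + ((eta0 n (w1.w j i) : ℤ) : ℝ)
        - p * ((eta0 n (w j i) : ℤ) : ℝ) := fun j i => by
    rw [hd1, hd2, ht]
    push_cast
    ring
  have hperm : ∀ j, w1.w j = w j ∧ w2.w j = Fin.revPerm * w j := fun j => by
    refine perm_eq_of_dominant (eta0_strictAnti n) (dominantPt.strictAnti h1 j)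
      (dominantPt.strictAnti h2 j) p _ _ _ (hrel j) ?_
    refine (hup.etaPair_le hnp j).trans (le_of_eq ?_)
    refine Finset.sum_congr rfl fun i _ => congrArg _ ?_
    simp [dotR, Wtf.mul, Wtf.inv, whElt, w0f, permAct, basePt]
    ring
  have hw1 : ∀ j, w1.w j = w j := fun j => (hperm j).1
  have hw2 : ∀ j, w2.w j = Fin.revPerm * w j := fun j => (hperm j).2
  refine ⟨?_, ?_, ?_, funext hw1⟩
  · funext j
    have h := hw j
    rw [hw1, hw2] at h
    exact (mul_right_cancel h).symm
  · obtain ⟨a, b⟩ := w2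
    simp only [Wtf.mul, Wtf.mk.injEq]
    refine ⟨funext fun j => ?_, funext fun j => funext fun i => ?_⟩
    · exact (hw2 j).trans (by rw [hw1]; rfl)
    · refine (ht j i).trans ?_
      simp [permAct, whElt, hw1, sub_eq_add_neg]
  · intro j i hi
    have hlt : i < (⟨(i : ℕ) + 1, hi⟩ : Fin n) := by simp [Fin.lt_def]
    refine ⟨h1 j _ _ hlt, ?_⟩
    have hdom := dominantPt.strictAnti h2 j (Fin.rev_lt_rev.2 hlt)
    have hx : ∀ k, dotR p w2 (basePt n f) j (Fin.rev k) + ((eta0 n (Fin.rev k) : ℤ) : ℝ)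
        = dotR p w1 (basePt n f) j k + ((eta0 n k : ℤ) : ℝ) - p * ((eta0 n k : ℤ) : ℝ) := fun k => by
      have h := hrel j ((w j)⁻¹ k)
      simpa [hw1, hw2] using h
    simp only [hx] at hdom
    have heta : ((eta0 n ⟨(i : ℕ) + 1, hi⟩ : ℤ) : ℝ) = ((eta0 n i : ℤ) : ℝ) - 1 := by
      simp [eta0]
      ring
    simp only [prR]
    rw [heta] at hdom ⊢
    linarith

end LLLSerre
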